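/- arXiv:1003.4474 — 4 statements merged into one kernel-verified Lean document; each statement's English description precedes it below -/
import Mathlib

section
/- Let $k, n, d$ be natural numbers with $1 \le k \le d$ and $n \ge 1$, and let $\lambda$ be a partition of $kn$ with at most $k$ parts. Then the subspace $\mathrm{Sym}^k(\mathrm{Sym}^{2n}\mathbb{C}^d) \subseteq (\mathbb{C}^d)^{\otimes 2nk}$ contains a highest weight vector of weight $2\lambda = (2\lambda_1, \ldots, 2\lambda_k, 0, \ldots, 0) \in \mathbb{N}^d$; that is, there is a nonzero vector $v$ in this subspace such that the line $\mathbb{C}v$ is stable under the action of the group of upper triangular matrices $\mathsf{B}_d \subseteq \mathsf{GL}_d(\mathbb{C})$ and $\mathrm{diag}(t_1,\ldots,t_d) \cdot v = t_1^{2\lambda_1} \cdots t_k^{2\lambda_k} v$ for all $t_i \in \mathbb{C}^\times$. (Equivalently, the irreducible $\mathsf{GL}_d(\mathbb{C})$-representation of highest weight $2\lambda$ occurs in the plethysm $\mathrm{Sym}^k(\mathrm{Sym}^{2n}\mathbb{C}^d)$: Weintraub's conjecture.) -/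
open scoped BigOperators

noncomputable section

/-- The tensor power `(ℂ^d)^{⊗ q}`, presented by coefficients in the computational basis
`|i₁ ⋯ i_q⟩`, `i_t ∈ {1, …, d}`. -/
abbrev Tens (d q : ℕ) : Type := (Fin q → Fin d) → ℂ

/-- The diagonal action of a `d × d` matrix on `(ℂ^d)^{⊗ q}`:
`g (v₁ ⊗ ⋯ ⊗ v_q) = g v₁ ⊗ ⋯ ⊗ g v_q`. -/
def glAct {d q : ℕ} (g : Matrix (Fin d) (Fin d) ℂ) (v : Tens d q) : Tens d q :=
  fun i => ∑ j : Fin q → Fin d, (∏ t, g (i t) (j t)) * v j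

/-- The action of a permutation `π ∈ S_q` on `(ℂ^d)^{⊗ q}` permuting the tensor factors:
`π (v₁ ⊗ ⋯ ⊗ v_q) = v_{π⁻¹(1)} ⊗ ⋯ ⊗ v_{π⁻¹(q)}`. -/
def permAct {d q : ℕ} (π : Equiv.Perm (Fin q)) (v : Tens d q) : Tens d q :=
  fun i => v (i ∘ π)

/-- The computational basis vector `|j₁ ⋯ j_q⟩`. -/
def ket {d q : ℕ} (j : Fin q → Fin d) : Tens d q :=
  fun i => if i = j then 1 else 0

/-- The standard Hermitian inner product on `(ℂ^d)^{⊗ q}` (conjugate-linear in the first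
argument), for which the computational basis is orthonormal. -/
def tinner {d q : ℕ} (v w : Tens d q) : ℂ :=
  ∑ i : Fin q → Fin d, (starRingEnd ℂ) (v i) * w i

/-- Upper triangular `d × d` matrices (entries below the diagonal vanish). -/
def IsUpperTriangular {d : ℕ} (g : Matrix (Fin d) (Fin d) ℂ) : Prop :=
  ∀ a b : Fin d, b < a → g a b = 0

/-- `v ∈ (ℂ^d)^{⊗ q}` is a highest weight vector of weight `μ ∈ ℕ^d`: it is nonzero, the line
`ℂ v` is stable under the Borel subgroup `B_d` of invertible upper triangular matrices, and
diagonal matrices act by `diag(t₁,…,t_d) v = t₁^{μ₁} ⋯ t_d^{μ_d} v`. -/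
def IsHWV {d q : ℕ} (μ : Fin d → ℕ) (v : Tens d q) : Prop :=
  v ≠ 0
  ∧ (∀ g : Matrix (Fin d) (Fin d) ℂ, IsUnit g.det → IsUpperTriangular g →
      ∃ c : ℂ, glAct g v = c • v)
  ∧ (∀ t : Fin d → ℂ, (∀ a, t a ≠ 0) →
      glAct (Matrix.diagonal t) v = (∏ a, t a ^ μ a) • v)

/-- A coherent state of weight `μ`: a vector of the form `π g v` with `v` a highest weight
vector of weight `μ`, `g ∈ GL_d(ℂ)` and `π ∈ S_q`. -/
def IsCoherent {d q : ℕ} (μ : Fin d → ℕ) (w : Tens d q) : Prop :=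
  ∃ (v : Tens d q) (g : Matrix (Fin d) (Fin d) ℂ) (π : Equiv.Perm (Fin q)),
    IsHWV μ v ∧ IsUnit g.det ∧ w = permAct π (glAct g v)

/-- The product `v ⊗ w` under the natural identification
`V^{⊗p} ⊗ V^{⊗q} ≅ V^{⊗(p+q)}`. -/
def tmul {d p q : ℕ} (v : Tens d p) (w : Tens d q) : Tens d (p + q) :=
  fun i => v (fun a => i (Fin.castAdd q a)) * w (fun b => i (Fin.natAdd p b))

/-- Transport along an equality of the number of tensor factors. -/
def castTens {d p q : ℕ} (h : p = q) (v : Tens d p) : Tens d q :=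
  fun i => v (fun a => i (Fin.cast h a))

/-- The element of `S_{kℓ}` determined by a permutation `τ ∈ S_k` of the `k` consecutive
blocks of size `ℓ` and permutations `σ_b ∈ S_ℓ` inside each block.  (Here `Fin (k * ℓ)` is
identified with `Fin k × Fin ℓ` via `finProdFinEquiv`, under which the pair
`(block, offset)` corresponds to `offset + ℓ * block`, i.e. blocks are consecutive of
size `ℓ`.)  These permutations form the wreath product `S_ℓ ≀ S_k ≤ S_{kℓ}`. -/
def blockPerm {k ℓ : ℕ} (τ : Equiv.Perm (Fin k)) (σ : Fin k → Equiv.Perm (Fin ℓ)) :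
    Equiv.Perm (Fin (k * ℓ)) :=
  finProdFinEquiv.symm.trans ((Equiv.prodShear τ σ).trans finProdFinEquiv)

/-- Membership in `Sym^k (Sym^ℓ ℂ^d) ⊆ (ℂ^d)^{⊗ kℓ}`, realized as the subspace of vectors
invariant under the wreath product `S_ℓ ≀ S_k` permuting the `k` consecutive blocks of
size `ℓ` among themselves and within themselves. -/
def InSymSym {d : ℕ} (k ℓ : ℕ) (v : Tens d (k * ℓ)) : Prop :=
  ∀ (τ : Equiv.Perm (Fin k)) (σ : Fin k → Equiv.Perm (Fin ℓ)),
    permAct (blockPerm τ σ) v = v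

/-- A weight on `{1, …, k}` padded with zeros to a weight on `{1, …, d}`. -/
def padWeight {k d : ℕ} (_ : k ≤ d) (lam : Fin k → ℕ) : Fin d → ℕ :=
  fun a => if h : (a : ℕ) < k then lam ⟨a, h⟩ else 0

/-- The Slater determinant `v_k = ∑_{π ∈ S_k} sgn(π) π |12⋯k⟩ ∈ (ℂ^d)^{⊗ k}`. -/
def slater (d k : ℕ) (h : k ≤ d) : Tens d k :=
  ∑ π : Equiv.Perm (Fin k),
    ((Equiv.Perm.sign π : ℤ) : ℂ) • permAct π (ket fun t => Fin.castLE h t)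

/-- The length `λ'_{j+1} = #{i : λ_i ≥ j+1}` of the `j`-th column (`0`-indexed) of the Young
diagram of `λ`; the conjugate partition. -/
def colLen (d : ℕ) (lam : Fin d → ℕ) (j : ℕ) : ℕ :=
  (Finset.univ.filter fun i : Fin d => j < lam i).card

lemma colLen_le (d : ℕ) (lam : Fin d → ℕ) (j : ℕ) : colLen d lam j ≤ d :=
  le_trans (Finset.card_filter_le _ _) (by simp)

/-- The tensor product `v 0 ⊗ v 1 ⊗ ⋯ ⊗ v (m-1) ∈ V^{⊗(c 0 + ⋯ + c (m-1))}` of a family of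
tensors `v j ∈ V^{⊗ c j}`. -/
def tprodFam {d : ℕ} : ∀ (m : ℕ) (c : Fin m → ℕ), (∀ j, Tens d (c j)) → Tens d (∑ j, c j)
  | 0, _, _ => fun _ => 1
  | m + 1, c, v =>
    castTens (Fin.sum_univ_succ c).symm
      (tmul (v 0) (tprodFam m (fun j => c j.succ) fun j => v j.succ))

/-- The highest weight vector `v_λ = v_{λ'_1} ⊗ v_{λ'_2} ⊗ ⋯ ⊗ v_{λ'_m}` of weight `λ`,
the tensor product of the Slater determinants along the `m = λ₁ = max_i λ_i` columns of the
Young diagram of `λ`. -/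
def vlam (d : ℕ) (lam : Fin d → ℕ) :
    Tens d (∑ j : Fin (Finset.univ.sup lam), colLen d lam (j : ℕ)) :=
  tprodFam (Finset.univ.sup lam) (fun j => colLen d lam (j : ℕ)) fun j =>
    slater d (colLen d lam (j : ℕ)) (colLen_le d lam (j : ℕ))

/-- The computational basis word `|i₁^{⊗n} i₂^{⊗n} ⋯ i_k^{⊗n}⟩ ∈ (ℂ^d)^{⊗ kn}`:
position `x` carries the letter `i_{⌊x/n⌋}`. -/
def blockWord (d k n : ℕ) (i : Fin k → Fin d) : Fin (k * n) → Fin d :=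
  fun x => i ⟨(x : ℕ) / n, Nat.div_lt_of_lt_mul (Nat.mul_comm k n ▸ x.isLt)⟩

/-- The computational basis word `|1^{⊗n} 2^{⊗n} ⋯ k^{⊗n}⟩ ∈ (ℂ^d)^{⊗ kn}`. -/
def baseWord (d k n : ℕ) (hkd : k ≤ d) : Fin (k * n) → Fin d :=
  blockWord d k n fun b => Fin.castLE hkd b

/-- The vector `ψ = φ^{⊗k} ∈ (ℂ^d)^{⊗ 2nk}` where `φ = ∑_{i=1}^d |i⟩^{⊗ 2n}`;
equivalently `ψ = ∑_{i₁,…,i_k} |i₁⟩^{⊗2n} ⊗ ⋯ ⊗ |i_k⟩^{⊗2n}`. -/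
def psiVec (d k n : ℕ) : Tens d (k * n + k * n) :=
  castTens (by ring) (∑ i : Fin k → Fin d, ket (blockWord d k (2 * n) i))

end
/-- The tensor whose coefficient at the word `i` is a product of minors of `M`, one for each
column `j` of a diagram with column lengths `c j`: the rows of the minor are the letters that `i`
has at the positions `p ⟨j, ·⟩`, and its columns are the first `c j` ones. -/
def minorTens {d q : ℕ} {J : Type*} [Fintype J] (c : J → ℕ) (hc : ∀ j, c j ≤ d)
    (M : Matrix (Fin d) (Fin d) ℂ) (p : (Σ j, Fin (c j)) → Fin q) : Tens d q :=
  fun i => ∏ j, Matrix.det (Matrix.of fun a b : Fin (c j) => M (i (p ⟨j, a⟩)) (Fin.castLE (hc j) b))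

section MinorTens

variable {d q : ℕ} {J : Type*} [Fintype J] {c : J → ℕ} (hc : ∀ j, c j ≤ d)

lemma minorTens_eq_sum [DecidableEq J] (M : Matrix (Fin d) (Fin d) ℂ)
    (p : (Σ j, Fin (c j)) → Fin q) (i : Fin q → Fin d) :
    minorTens c hc M p i = ∑ σ : ∀ j, Equiv.Perm (Fin (c j)),
      (∏ j, ((Equiv.Perm.sign (σ j) : ℤ) : ℂ)) *
        ∏ x : Σ j, Fin (c j), M (i (p x)) (Fin.castLE (hc x.1) (σ x.1 x.2)) := by
  simp only [minorTens]
  simp_rw [← Matrix.det_transpose (Matrix.of _), Matrix.det_apply', Matrix.transpose_apply,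
    Matrix.of_apply]
  rw [Finset.prod_univ_sum]
  simp only [Fintype.piFinset_univ, Finset.prod_mul_distrib, Fintype.prod_sigma]

lemma glAct_minorTens_one (g : Matrix (Fin d) (Fin d) ℂ) (p : (Σ j, Fin (c j)) ≃ Fin q) :
    glAct g (minorTens c hc 1 p) = minorTens c hc g p := by
  classical
  funext i
  simp only [glAct, minorTens_eq_sum, Finset.mul_sum]
  rw [Finset.sum_comm]
  refine Finset.sum_congr rfl fun σ _ => ?_
  simp only [mul_left_comm _ (∏ j, ((Equiv.Perm.sign (σ j) : ℤ) : ℂ)), ← Finset.mul_sum]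
  congr 1
  let f : (Σ j, Fin (c j)) → Fin d := fun x => Fin.castLE (hc x.1) (σ x.1 x.2)
  let r : Fin q → Fin d := f ∘ p.symm
  have h : ∀ (A : Matrix (Fin d) (Fin d) ℂ) (j : Fin q → Fin d),
      ∏ x : Σ j, Fin (c j), A (j (p x)) (Fin.castLE (hc x.1) (σ x.1 x.2)) =
        ∏ t, A (j t) (r t) := fun A j => by
    rw [← p.prod_comp]
    exact Finset.prod_congr rfl fun x _ =>
      congrArg (A _) (congrArg f (p.symm_apply_apply x).symm)
  simp only [h, ← Finset.prod_mul_distrib]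
  rw [← Fintype.piFinset_univ, ← Finset.prod_univ_sum (fun _ => Finset.univ)
    (fun t s => g (i t) s * (1 : Matrix (Fin d) (Fin d) ℂ) s (r t))]
  simp [Matrix.one_apply]

lemma minorTens_of_isUpperTriangular {g : Matrix (Fin d) (Fin d) ℂ} (hg : IsUpperTriangular g)
    (p : (Σ j, Fin (c j)) → Fin q) :
    minorTens c hc g p =
      (∏ j, (g.submatrix (Fin.castLE (hc j)) (Fin.castLE (hc j))).det) • minorTens c hc 1 p := by
  funext i
  simp only [minorTens, Pi.smul_apply, smul_eq_mul, ← Finset.prod_mul_distrib]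
  refine Finset.prod_congr rfl fun j _ => ?_
  rw [mul_comm, ← Matrix.det_mul]
  congr 1
  ext a b
  simp only [Matrix.of_apply, Matrix.mul_apply, Matrix.submatrix_apply, Matrix.one_apply, ite_mul,
    one_mul, zero_mul]
  by_cases h : (i (p ⟨j, a⟩) : ℕ) < c j
  · rw [Finset.sum_eq_single ⟨_, h⟩]
    · simp
    · intro b' _ hb'
      refine if_neg fun h' => hb' ?_
      ext
      simp [h']
    · simp
  · rw [hg _ _ (by rw [Fin.lt_def, Fin.val_castLE]; omega), Finset.sum_eq_zero]
    intro b' _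
    refine if_neg fun h' => h ?_
    rw [h']
    exact b'.isLt

lemma minorTens_comp (M : Matrix (Fin d) (Fin d) ℂ) (p : (Σ j, Fin (c j)) → Fin q)
    (π : Fin q → Fin q) (i : Fin q → Fin d) :
    minorTens c hc M p (i ∘ π) = minorTens c hc M (π ∘ p) i := rfl

end MinorTens

lemma glAct_sum {d q : ℕ} {ι : Type*} [Fintype ι] (g : Matrix (Fin d) (Fin d) ℂ)
    (v : ι → Tens d q) : glAct g (∑ s, v s) = ∑ s, glAct g (v s) := by
  funext i
  simp only [glAct, Finset.sum_apply, Finset.mul_sum]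
  exact Finset.sum_comm

/-- The block containing a position. -/
def blockOf {k l : ℕ} (x : Fin (k * l)) : Fin k := (finProdFinEquiv.symm x).1

/-- The permutations that permute the `k` consecutive blocks of size `l` among themselves. -/
def blockSubgroup (k l : ℕ) : Subgroup (Equiv.Perm (Fin (k * l))) where
  carrier := {π | ∀ x y, blockOf (π x) = blockOf (π y) ↔ blockOf x = blockOf y}
  one_mem' := fun _ _ => Iff.rfl
  mul_mem' := fun ha hb x y => (ha _ _).trans (hb x y)
  inv_mem' := fun {π} ha x y => by simpa using (ha (π⁻¹ x) (π⁻¹ y)).symm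

lemma blockPerm_mem {k l : ℕ} (τ : Equiv.Perm (Fin k)) (σ : Fin k → Equiv.Perm (Fin l)) :
    blockPerm τ σ ∈ blockSubgroup k l := fun x y => by
  simp [blockPerm, blockOf]

open Classical in
/-- The projection of `minorTens c hc 1 p` to `Sym^k (Sym^l ℂ^d)`, up to a scalar. -/
noncomputable def symMinorTens {d k l : ℕ} {J : Type*} [Fintype J] (c : J → ℕ) (hc : ∀ j, c j ≤ d)
    (p : (Σ j, Fin (c j)) ≃ Fin (k * l)) : Tens d (k * l) :=
  ∑ π : blockSubgroup k l, minorTens c hc 1 (p.trans π.1)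

section SymMinorTens

variable {d k l : ℕ} {J : Type*} [Fintype J] {c : J → ℕ} (hc : ∀ j, c j ≤ d)
  (p : (Σ j, Fin (c j)) ≃ Fin (k * l))

lemma inSymSym_symMinorTens : InSymSym k l (symMinorTens c hc p) := by
  classical
  intro τ σ
  funext i
  simp only [permAct, symMinorTens, Finset.sum_apply, minorTens_comp]
  exact Fintype.sum_equiv (Equiv.mulLeft (⟨_, blockPerm_mem τ σ⟩ : blockSubgroup k l)) _ _
    fun π => rfl

lemma glAct_symMinorTens_of_isUpperTriangular {g : Matrix (Fin d) (Fin d) ℂ}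
    (hg : IsUpperTriangular g) :
    glAct g (symMinorTens c hc p) =
      (∏ j, (g.submatrix (Fin.castLE (hc j)) (Fin.castLE (hc j))).det) • symMinorTens c hc p := by
  classical
  simp only [symMinorTens, glAct_sum, glAct_minorTens_one,
    minorTens_of_isUpperTriangular hc hg, Finset.smul_sum]

lemma glAct_diagonal_symMinorTens (t : Fin d → ℂ) :
    glAct (Matrix.diagonal t) (symMinorTens c hc p) =
      (∏ a : Fin d, t a ^ (Finset.univ.filter fun j => (a : ℕ) < c j).card) •
        symMinorTens c hc p := by
  rw [glAct_symMinorTens_of_isUpperTriangular hc p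
    fun a b h => Matrix.diagonal_apply_ne t h.ne']
  congr 1
  have h : ∀ j, ((Matrix.diagonal t).submatrix (Fin.castLE (hc j)) (Fin.castLE (hc j))).det =
      ∏ a : Fin d, if (a : ℕ) < c j then t a else 1 := fun j => by
    rw [Matrix.submatrix_diagonal _ _ (Fin.castLE_injective (hc j)), Matrix.det_diagonal,
      Finset.prod_ite, Finset.prod_const_one, mul_one]
    refine Finset.prod_bij (fun b _ => Fin.castLE (hc j) b) ?_ ?_ ?_ ?_
    · simp
    · intro a _ b _ h
      exact Fin.castLE_injective _ h
    · intro a ha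
      exact ⟨⟨a, (Finset.mem_filter.mp ha).2⟩, Finset.mem_univ _, rfl⟩
    · simp
  simp only [h]
  rw [Finset.prod_comm]
  refine Finset.prod_congr rfl fun a _ => ?_
  rw [Finset.prod_ite, Finset.prod_const_one, mul_one, Finset.prod_const]

end SymMinorTens

/-- If every column of a diagram occurs twice, and the two copies of each cell lie in the same
block while distinct cells of a column lie in different blocks, then the projection to
`Sym^k (Sym^l ℂ^d)` does not vanish. -/
lemma symMinorTens_ne_zero {d k l : ℕ} (hkd : k ≤ d) {J : Type*} [Fintype J] {c : J → ℕ}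
    (hc : ∀ j, c j ≤ d) (p : (Σ s : J × Bool, Fin (c s.1)) ≃ Fin (k * l))
    (hp : ∀ j a, blockOf (p ⟨(j, true), a⟩) = blockOf (p ⟨(j, false), a⟩))
    (hinj : ∀ j, Function.Injective fun a => blockOf (p ⟨(j, false), a⟩)) :
    symMinorTens (fun s : J × Bool => c s.1) (fun s => hc s.1) p ≠ 0 := by
  classical
  intro h0
  let A : Matrix (Fin d) (Fin d) ℝ := Matrix.of fun a b => (a : ℝ) ^ (b : ℕ)
  let i₀ : Fin (k * l) → Fin d := fun x => Fin.castLE hkd (blockOf x)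
  let D : Equiv.Perm (Fin (k * l)) → J → ℝ := fun π j =>
    Matrix.det (Matrix.of fun a b : Fin (c j) =>
      A (i₀ (π (p ⟨(j, false), a⟩))) (Fin.castLE (hc j) b))
  have key : ∀ π : blockSubgroup k l,
      minorTens (fun s : J × Bool => c s.1) (fun s => hc s.1) (A.map Complex.ofReal)
        (p.trans π.1) i₀ = ((∏ j, D π.1 j ^ 2 : ℝ) : ℂ) := fun π => by
    have hdet : ∀ j (s : Bool), Matrix.det (Matrix.of fun a b : Fin (c j) =>
        (A.map Complex.ofReal) (i₀ (π.1 (p ⟨(j, s), a⟩))) (Fin.castLE (hc j) b)) =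
          (D π.1 j : ℂ) := fun j s => by
      have hs : ∀ a, i₀ (π.1 (p ⟨(j, s), a⟩)) = i₀ (π.1 (p ⟨(j, false), a⟩)) := fun a => by
        cases s
        · rfl
        · exact congrArg (Fin.castLE hkd) ((π.2 _ _).2 (hp j a))
      simp only [hs]
      exact (RingHom.map_det Complex.ofRealHom _).symm
    simp only [minorTens, Equiv.trans_apply, Fintype.prod_prod_type,
      Fintype.prod_bool, hdet]
    push_cast
    exact Finset.prod_congr rfl fun j _ => (sq _).symm
  have hsum : glAct (A.map Complex.ofReal)
      (symMinorTens (fun s : J × Bool => c s.1) (fun s => hc s.1) p) i₀ =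
        ((∑ π : blockSubgroup k l, ∏ j, D π.1 j ^ 2 : ℝ) : ℂ) := by
    rw [symMinorTens, glAct_sum, Finset.sum_apply, Complex.ofReal_sum]
    exact Finset.sum_congr rfl fun π _ => by rw [glAct_minorTens_one, key]
  have hD : ∀ j, D 1 j ≠ 0 := fun j => by
    refine (Matrix.det_vandermonde_ne_zero_iff
      (v := fun a : Fin (c j) => ((i₀ (p ⟨(j, false), a⟩) : ℕ) : ℝ))).2 fun a b hab => hinj j ?_
    exact Fin.castLE_injective hkd (Fin.ext (Nat.cast_injective hab))
  have hpos : 0 < ∑ π : blockSubgroup k l, ∏ j, D π.1 j ^ 2 := by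
    refine Finset.sum_pos' (fun π _ => Finset.prod_nonneg fun j _ => sq_nonneg _)
      ⟨1, Finset.mem_univ _, Finset.prod_pos fun j _ => sq_pos_of_ne_zero (hD j)⟩
  rw [h0] at hsum
  refine hpos.ne' (Complex.ofReal_injective ?_)
  rw [← hsum]
  simp [glAct]

/-- The cells of a diagram with `k * n` cells in columns of length at most `k` can be filled with
`k` letters, each used `n` times, so that the letters in each column are distinct. -/
lemma exists_balanced_filling {k n m : ℕ} (c : Fin m → ℕ) (hc : ∀ j, c j ≤ k)
    (hsum : ∑ j, c j = k * n) :
    ∃ E : (Σ j, Fin (c j)) ≃ Fin k × Fin n, ∀ j, Function.Injective fun a => (E ⟨j, a⟩).1 := by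
  refine ⟨finSigmaFinEquiv.trans ((finCongr (hsum.trans (mul_comm k n))).trans
    (finProdFinEquiv.symm.trans (Equiv.prodComm _ _))), fun j a b hab => ?_⟩
  have h := congrArg Fin.val hab
  simp [finSigmaFinEquiv_apply, Fin.modNat] at h
  have h' := Nat.ModEq.add_left_cancel' _ h
  have ha := a.isLt.trans_le (hc j)
  have hb := b.isLt.trans_le (hc j)
  exact Fin.ext (by rwa [Nat.ModEq, Nat.mod_eq_of_lt ha, Nat.mod_eq_of_lt hb] at h')

/-- A filling extends to the diagram with every column repeated, using every letter twice as
often. -/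
lemma exists_doubled_filling {k n : ℕ} {J : Type*} {c : J → ℕ}
    (E : (Σ j, Fin (c j)) ≃ Fin k × Fin n) :
    ∃ p : (Σ s : J × Bool, Fin (c s.1)) ≃ Fin (k * (2 * n)),
      ∀ j s a, blockOf (p ⟨(j, s), a⟩) = (E ⟨j, a⟩).1 := by
  let F : Fin n × Bool ≃ Fin (2 * n) := Fintype.equivFinOfCardEq (by simp [mul_comm])
  let G : (Σ s : J × Bool, Fin (c s.1)) ≃ (Σ j, Fin (c j)) × Bool :=
    { toFun := fun x => (⟨x.1.1, x.2⟩, x.1.2)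
      invFun := fun y => ⟨(y.1.1, y.2), y.1.2⟩
      left_inv := fun _ => rfl
      right_inv := fun _ => rfl }
  refine ⟨G.trans ((E.prodCongr (Equiv.refl _)).trans ((Equiv.prodAssoc _ _ _).trans
    (((Equiv.refl _).prodCongr F).trans finProdFinEquiv))), fun j s a => ?_⟩
  simp [blockOf, G]

lemma lt_colLen_iff {k : ℕ} {lam : Fin k → ℕ} (hlam : Antitone lam) (b : Fin k) (j : ℕ) :
    (b : ℕ) < colLen k lam j ↔ j < lam b := by
  constructor
  · intro h
    by_contra! hj
    have hsub : (Finset.univ.filter fun i : Fin k => j < lam i) ⊆ Finset.Iio b := fun i hi => by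
      rw [Finset.mem_Iio]
      by_contra! hbi
      exact absurd ((Finset.mem_filter.mp hi).2.trans_le (hlam hbi)) hj.not_gt
    have := Finset.card_le_card hsub
    rw [Fin.card_Iio] at this
    exact absurd h this.not_gt
  · intro h
    have hsub : Finset.Iic b ⊆ Finset.univ.filter fun i : Fin k => j < lam i := fun i hi =>
      Finset.mem_filter.mpr ⟨Finset.mem_univ _, h.trans_le (hlam (Finset.mem_Iic.mp hi))⟩
    have := Finset.card_le_card hsub
    rwa [Fin.card_Iic] at this

lemma card_filter_val_lt {m r : ℕ} (h : r ≤ m) :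
    (Finset.univ.filter fun j : Fin m => (j : ℕ) < r).card = r := by
  rw [Fin.card_filter_val_lt, min_eq_right h]

lemma sum_colLen {k m : ℕ} {lam : Fin k → ℕ} (h : ∀ i, lam i ≤ m) :
    ∑ j : Fin m, colLen k lam j = ∑ i, lam i := by
  simp only [colLen, Finset.card_filter]
  rw [Finset.sum_comm]
  exact Finset.sum_congr rfl fun i _ => by rw [← Finset.card_filter, card_filter_val_lt (h i)]

/-- **Weintraub's conjecture** (the Main Theorem):  for `1 ≤ k ≤ d`, `n ≥ 1` and every
partition `λ` of `kn` with at most `k` parts, the subspace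
`Sym^k(Sym^{2n} ℂ^d) ⊆ (ℂ^d)^{⊗ 2nk}` contains a highest weight vector of weight
`2λ = (2λ₁, …, 2λ_k, 0, …, 0) ∈ ℕ^d`; i.e. the irreducible `GL_d(ℂ)`-representation of
highest weight `2λ` occurs in the plethysm `Sym^k(Sym^{2n} ℂ^d)`. -/
theorem weintraub_conjecture (k n d : ℕ) (hk : 1 ≤ k) (hkd : k ≤ d) (hn : 1 ≤ n)
    (lam : Fin k → ℕ) (hlam : Antitone lam) (hsum : ∑ i, lam i = k * n) :
    ∃ v : Tens d (k * (2 * n)),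
      InSymSym k (2 * n) v ∧ IsHWV (padWeight hkd fun i => 2 * lam i) v := by
  set m := Finset.univ.sup lam
  have hm : ∀ i, lam i ≤ m := fun i => Finset.le_sup (Finset.mem_univ i)
  let c : Fin m → ℕ := fun j => colLen k lam j
  have hck : ∀ j, c j ≤ k := fun j => colLen_le k lam j
  have hcd : ∀ j, c j ≤ d := fun j => (hck j).trans hkd
  obtain ⟨E, hE⟩ := exists_balanced_filling c hck ((sum_colLen hm).trans hsum)
  obtain ⟨p, hp⟩ := exists_doubled_filling E
  refine ⟨symMinorTens (fun s : Fin m × Bool => c s.1) (fun s => hcd s.1) p,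
    inSymSym_symMinorTens _ p, ?_, fun g _ hg => ⟨_, glAct_symMinorTens_of_isUpperTriangular _ p hg⟩,
    fun t _ => ?_⟩
  · exact symMinorTens_ne_zero hkd hcd p (fun j a => by rw [hp, hp])
      fun j => by simpa only [hp] using hE j
  · rw [glAct_diagonal_symMinorTens]
    congr 1
    refine Finset.prod_congr rfl fun a _ => congrArg (t a ^ ·) ?_
    have hprod : (Finset.univ.filter fun s : Fin m × Bool => (a : ℕ) < c s.1) =
        (Finset.univ.filter fun j => (a : ℕ) < c j) ×ˢ Finset.univ := by
      ext
      simp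
    rw [hprod, Finset.card_product, Finset.card_univ, Fintype.card_bool, padWeight, mul_comm]
    split_ifs with h
    · congr 1
      simp only [c, lt_colLen_iff hlam ⟨a, h⟩]
      exact card_filter_val_lt (hm _)
    · rw [Finset.filter_false_of_mem fun j _ hj => h (hj.trans_le (hck j)), Finset.card_empty, mul_zero]
end

section
/- Let $k \le d$, $n \ge 1$, and let $\lambda$ be a partition of $kn$ into at most $k$ parts. Let $v_\lambda \in (\mathbb{C}^d)^{\otimes kn}$ be the highest weight vector of weight $\lambda$ given by the tensor product of Slater determinants along the columns of $\lambda$. Then the linear span of the orbit $\mathsf{GL}_d(\mathbb{C}) \cdot v_\lambda$ contains a nonzero vector $u$ of the form $u = \sum_{\pi \in \mathsf{S}_{nk}} \alpha_\pi\, \pi \cdot |1^{\otimes n} 2^{\otimes n} \cdots k^{\otimes n}\rangle$ for some coefficients $\alpha_\pi \in \mathbb{C}$, where $|1^{\otimes n} 2^{\otimes n} \cdots k^{\otimes n}\rangle = |1\rangle^{\otimes n} \otimes |2\rangle^{\otimes n} \otimes \cdots \otimes |k\rangle^{\otimes n}$. -/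
open scoped BigOperators

/-- The number of occurrences of the letter `a` in the word `i`. -/
def letterCount {d q : ℕ} (i : Fin q → Fin d) (a : Fin d) : ℕ :=
  (Finset.univ.filter fun t => i t = a).card

lemma letterCount_le {d q : ℕ} (i : Fin q → Fin d) (a : Fin d) : letterCount i a ≤ q :=
  (Finset.card_filter_le _ _).trans (by simp)

lemma letterCount_comp_perm {d q : ℕ} (i : Fin q → Fin d) (σ : Equiv.Perm (Fin q))
    (a : Fin d) : letterCount (i ∘ σ) a = letterCount i a := by
  unfold letterCount
  refine Finset.card_bij (fun t _ => σ t) ?_ ?_ ?_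
  · intro t ht
    simpa using ht
  · intro s _ t _ h
    exact σ.injective h
  · intro t ht
    exact ⟨σ.symm t, by simpa using ht, by simp⟩

/-- Words with the same letter counts differ by a permutation of the positions. -/
lemma exists_perm_of_letterCount_eq {d q : ℕ} {i j : Fin q → Fin d}
    (h : ∀ a, letterCount i a = letterCount j a) :
    ∃ σ : Equiv.Perm (Fin q), j ∘ σ = i := by
  have e : ∀ a, Nonempty ({t // i t = a} ≃ {t // j t = a}) := fun a => by
    refine Fintype.card_eq.mp ?_
    rw [Fintype.card_subtype, Fintype.card_subtype]
    exact h a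
  exact ⟨Equiv.ofFiberEquiv fun a => (e a).some, funext fun t => Equiv.ofFiberEquiv_map _ t⟩

lemma prod_letters {d q : ℕ} (z : Fin d → ℂ) (i : Fin q → Fin d) :
    ∏ t, z (i t) = ∏ a, z a ^ letterCount i a := by
  rw [← Finset.prod_fiberwise' Finset.univ i z]
  simp [letterCount]

/-- Orthogonality of the characters of the cyclic group of order `N`. -/
lemma IsPrimitiveRoot.sum_pow_mul_sub {N : ℕ} {ζ : ℂ} (hζ : IsPrimitiveRoot ζ N)
    {a b : ℕ} (ha : a < N) (hb : b < N) :
    ∑ m : Fin N, ζ ^ ((m : ℕ) * (N - b)) * (ζ ^ (m : ℕ)) ^ a = if a = b then (N : ℂ) else 0 := by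
  have key : ∀ m : Fin N, ζ ^ ((m : ℕ) * (N - b)) * (ζ ^ (m : ℕ)) ^ a
      = (ζ ^ (N - b + a)) ^ (m : ℕ) := fun m => by
    rw [← pow_mul, ← pow_add, ← pow_mul]
    congr 1
    ring
  simp_rw [key]
  rw [Fin.sum_univ_eq_sum_range (fun m => (ζ ^ (N - b + a)) ^ m) N]
  split_ifs with hab
  · subst hab
    rw [Nat.sub_add_cancel ha.le, hζ.pow_eq_one]
    simp
  · have hne : ζ ^ (N - b + a) ≠ 1 := fun h => by
      obtain ⟨c, hc⟩ := (hζ.pow_eq_one_iff_dvd _).mp h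
      rcases Nat.lt_or_ge c 2 with hc2 | hc2
      · interval_cases c <;> omega
      · have := Nat.mul_le_mul_left N hc2
        omega
    have hpow : (ζ ^ (N - b + a)) ^ N = 1 := by
      rw [← pow_mul, mul_comm, pow_mul, hζ.pow_eq_one, one_pow]
    rw [geom_sum_eq hne, hpow]
    simp

/-- A subspace containing the torus orbit of `w` contains every weight component of `w`. -/
lemma weight_component_mem {d q : ℕ} (W : Submodule ℂ (Tens d q)) (w : Tens d q)
    (hW : ∀ z : Fin d → ℂ, (∀ a, z a ≠ 0) →
      (fun i => (∏ t, z (i t)) * w i : Tens d q) ∈ W)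
    (μ : Fin d → ℕ) (hμ : ∀ a, μ a ≤ q) :
    (fun i => if ∀ a, letterCount i a = μ a then w i else 0 : Tens d q) ∈ W := by
  obtain ⟨N, hN⟩ : ∃ N, N = q + 1 := ⟨_, rfl⟩
  have hN0 : (N : ℂ) ≠ 0 := Nat.cast_ne_zero.mpr (by omega)
  obtain ⟨ζ, hζ⟩ : ∃ ζ : ℂ, IsPrimitiveRoot ζ N :=
    ⟨_, Complex.isPrimitiveRoot_exp N (by omega)⟩
  have hζ0 : ζ ≠ 0 := hζ.ne_zero (by omega)
  have hmem : ((N : ℂ) ^ d)⁻¹ • ∑ m : Fin d → Fin N,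
      (∏ a, ζ ^ ((m a : ℕ) * (N - μ a))) •
        (fun i => (∏ t, ζ ^ (m (i t) : ℕ)) * w i : Tens d q) ∈ W :=
    W.smul_mem _ (W.sum_mem fun m _ => W.smul_mem _
      (hW (fun a => ζ ^ (m a : ℕ)) fun a => pow_ne_zero _ hζ0))
  convert hmem using 1
  funext i
  have hsum : ∑ m : Fin d → Fin N,
      (∏ a, ζ ^ ((m a : ℕ) * (N - μ a))) * ∏ t, ζ ^ (m (i t) : ℕ)
      = if ∀ a, letterCount i a = μ a then (N : ℂ) ^ d else 0 := by
    calc _ = ∑ m : Fin d → Fin N, ∏ a,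
          ζ ^ ((m a : ℕ) * (N - μ a)) * (ζ ^ (m a : ℕ)) ^ letterCount i a := by
            refine Finset.sum_congr rfl fun m _ => ?_
            rw [prod_letters (fun a => ζ ^ (m a : ℕ)) i, Finset.prod_mul_distrib]
      _ = ∏ a, ∑ m : Fin N, ζ ^ ((m : ℕ) * (N - μ a)) * (ζ ^ (m : ℕ)) ^ letterCount i a := by
            rw [Finset.prod_univ_sum, Fintype.piFinset_univ]
      _ = ∏ a, if letterCount i a = μ a then (N : ℂ) else 0 :=
            Finset.prod_congr rfl fun a _ => hζ.sum_pow_mul_sub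
              (by have := letterCount_le i a; omega) (by have := hμ a; omega)
      _ = _ := by
            split_ifs with h
            · simp [h]
            · push Not at h
              obtain ⟨a, ha⟩ := h
              exact Finset.prod_eq_zero (Finset.mem_univ a) (if_neg ha)
  simp only [Pi.smul_apply, Finset.sum_apply, smul_eq_mul, ← mul_assoc]
  rw [← Finset.sum_mul, hsum]
  split_ifs
  · field_simp
  · simp

lemma glAct_diagonal_mul {d q : ℕ} (z : Fin d → ℂ) (g : Matrix (Fin d) (Fin d) ℂ)
    (v : Tens d q) :
    glAct (Matrix.diagonal z * g) v = fun i => (∏ t, z (i t)) * glAct g v i := by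
  funext i
  simp only [glAct, Matrix.diagonal_mul, Finset.prod_mul_distrib, Finset.mul_sum, mul_assoc]

lemma glAct_castTens {d p q : ℕ} (h : p = q) (g : Matrix (Fin d) (Fin d) ℂ) (v : Tens d p) :
    glAct g (castTens h v) = castTens h (glAct g v) := by
  subst h
  rfl

lemma glAct_tmul {d p q : ℕ} (g : Matrix (Fin d) (Fin d) ℂ) (v : Tens d p) (w : Tens d q) :
    glAct g (tmul v w) = tmul (glAct g v) (glAct g w) := by
  funext i
  simp only [glAct, tmul]
  rw [Finset.sum_mul_sum, ← Finset.sum_product', Finset.univ_product_univ,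
    ← (Fin.appendEquiv p q).sum_comp]
  refine Finset.sum_congr rfl fun x _ => ?_
  simp only [Fin.appendEquiv, Equiv.coe_fn_mk, Fin.prod_univ_add, Fin.append_left,
    Fin.append_right]
  ring

lemma glAct_slater {d c : ℕ} (h : c ≤ d) (g : Matrix (Fin d) (Fin d) ℂ) (i : Fin c → Fin d) :
    glAct g (slater d c h) i = (Matrix.of fun t s => g (i t) (Fin.castLE h s)).det := by
  have key : ∀ (π : Equiv.Perm (Fin c)) (j : Fin c → Fin d),
      permAct π (ket fun t => Fin.castLE h t) j
        = if j = fun t => Fin.castLE h (π.symm t) then (1 : ℂ) else 0 := fun π j => by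
    have : (j ∘ π = fun t => Fin.castLE h t) ↔ j = fun t => Fin.castLE h (π.symm t) := by
      constructor
      · intro hj
        funext t
        simpa using congrFun hj (π.symm t)
      · rintro rfl
        funext t
        simp
    simp only [permAct, ket, this]
  simp only [glAct, slater, Finset.sum_apply, Pi.smul_apply, smul_eq_mul, key, Finset.mul_sum]
  rw [Finset.sum_comm, ← Matrix.det_transpose, Matrix.det_apply',
    ← Equiv.sum_comp (Equiv.inv (Equiv.Perm (Fin c)))]
  refine Finset.sum_congr rfl fun π _ => ?_
  simp [mul_comm, Equiv.Perm.inv_def]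

/-- Vandermonde matrices have nonvanishing minors on their leading columns. -/
lemma glAct_vandermonde_slater_ne_zero {d c : ℕ} (h : c ≤ d) {i : Fin c → Fin d}
    (hi : Function.Injective i) :
    glAct (Matrix.vandermonde fun a : Fin d => ((a : ℕ) : ℂ)) (slater d c h) i ≠ 0 := by
  rw [glAct_slater]
  have hV : (Matrix.of fun t s => Matrix.vandermonde (fun a : Fin d => ((a : ℕ) : ℂ)) (i t)
      (Fin.castLE h s)) = Matrix.vandermonde fun t => ((i t : ℕ) : ℂ) := by
    ext t s
    simp [Matrix.vandermonde_apply]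
  rw [hV, Matrix.det_vandermonde_ne_zero_iff]
  intro s t hst
  exact hi (Fin.ext (Nat.cast_injective hst))

/-- The cyclic filling has distinct letters in every column, so the corresponding coefficient of
the Vandermonde translate of a product of Slater determinants does not vanish. -/
lemma glAct_vandermonde_tprodFam_ne_zero {d k : ℕ} (m : ℕ) (c : Fin m → ℕ)
    (hc : ∀ j, c j ≤ k) (hd : ∀ j, c j ≤ d) (s : ℕ) (i : Fin (∑ j, c j) → Fin d)
    (hi : ∀ x, (i x : ℕ) = (s + x) % k) :
    glAct (Matrix.vandermonde fun a : Fin d => ((a : ℕ) : ℂ))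
      (tprodFam m c fun j => slater d (c j) (hd j)) i ≠ 0 := by
  induction m generalizing s with
  | zero =>
    have : IsEmpty (Fin (∑ j : Fin 0, c j)) := by
      simp only [Finset.univ_eq_empty, Finset.sum_empty]
      infer_instance
    simp [glAct, tprodFam]
  | succ m ih =>
    simp only [tprodFam]
    rw [glAct_castTens, glAct_tmul]
    refine mul_ne_zero (glAct_vandermonde_slater_ne_zero _ ?_)
      (ih (fun j => c j.succ) (fun j => hc _) (fun j => hd _) (s + c 0) _ fun x => ?_)
    · intro x y hxy
      have h := congrArg Fin.val hxy
      simp only [hi, Fin.val_cast, Fin.val_castAdd] at h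
      have hmod : (x : ℕ) ≡ y [MOD k] := Nat.ModEq.add_left_cancel' s h
      exact Fin.ext (hmod.eq_of_lt_of_lt (x.isLt.trans_le (hc 0)) (y.isLt.trans_le (hc 0)))
    · simp [hi, add_assoc]

lemma colLen_padWeight_le {k d : ℕ} (hkd : k ≤ d) (lam : Fin k → ℕ) (j : ℕ) :
    colLen d (padWeight hkd lam) j ≤ k := by
  refine (Finset.card_le_card_of_injOn (t := Finset.range k) (fun a : Fin d => (a : ℕ)) ?_
    Fin.val_injective.injOn).trans_eq (Finset.card_range k)
  intro a ha
  have hlt : j < padWeight hkd lam a := (Finset.mem_filter.mp (Finset.mem_coe.mp ha)).2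
  refine Finset.mem_coe.mpr (Finset.mem_range.mpr ?_)
  by_contra hak
  rw [padWeight, dif_neg hak] at hlt
  exact Nat.not_lt_zero _ hlt

/-- The cyclic word `12⋯k12⋯k⋯` is a rearrangement of `1^n 2^n ⋯ k^n`. -/
lemma exists_perm_baseWord_comp_eq_mod (d k n : ℕ) (hkd : k ≤ d) :
    ∃ σ : Equiv.Perm (Fin (k * n)),
      ∀ x, ((baseWord d k n hkd (σ x) : Fin d) : ℕ) = (x : ℕ) % k := by
  refine ⟨(finCongr (mul_comm k n)).trans (finProdFinEquiv.symm.trans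
    ((Equiv.prodComm _ _).trans finProdFinEquiv)), fun x => ?_⟩
  have hn : 0 < n := Nat.pos_of_mul_pos_left (Nat.zero_lt_of_lt x.isLt)
  have hlt : (x : ℕ) / k < n := Nat.div_lt_of_lt_mul x.isLt
  simp [baseWord, blockWord, finProdFinEquiv, Fin.divNat, Fin.modNat,
    Nat.add_mul_div_left _ _ hn, Nat.div_eq_of_lt hlt]

lemma mem_span_permAct_ket {d q : ℕ} (b : Fin q → Fin d) (u : Tens d q)
    (hu : ∀ i, u i ≠ 0 → ∃ σ : Equiv.Perm (Fin q), b ∘ σ = i) :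
    u ∈ Submodule.span ℂ (Set.range fun π : Equiv.Perm (Fin q) => permAct π (ket b)) := by
  have hexp : u = ∑ i, u i • ket i := by
    funext j
    simp [ket, Finset.sum_apply]
  rw [hexp]
  refine Submodule.sum_mem _ fun i _ => ?_
  by_cases hi : u i = 0
  · simp [hi]
  obtain ⟨σ, rfl⟩ := hu i hi
  refine Submodule.smul_mem _ _ (Submodule.subset_span ⟨σ⁻¹, ?_⟩)
  funext j
  have : j ∘ ⇑σ⁻¹ = b ↔ j = b ∘ σ := by
    constructor
    · rintro rfl
      funext t
      simp
    · rintro rfl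
      funext t
      simp
  simp only [permAct, ket, this]

/-- Lemma 7 of the paper.  For `k ≤ d`, `n ≥ 1` and a partition `λ` of `kn` into at most
`k` parts, the linear span of the orbit `GL_d(ℂ) · v_λ` of the highest weight vector
`v_λ ∈ (ℂ^d)^{⊗ kn}` (the tensor product of Slater determinants along the columns of `λ`)
contains a nonzero vector `u` of the form
`u = ∑_{π ∈ S_{nk}} α_π π |1^{⊗n} 2^{⊗n} ⋯ k^{⊗n}⟩` with `α_π ∈ ℂ`. -/
theorem exists_weight_vector_in_orbit_span (d k n : ℕ) (hk : 1 ≤ k) (hkd : k ≤ d)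
    (hn : 1 ≤ n) (lam : Fin k → ℕ) (hlam : Antitone lam) (hsum : ∑ i, lam i = k * n)
    (hq : ∑ j : Fin (Finset.univ.sup (padWeight hkd lam)),
        colLen d (padWeight hkd lam) (j : ℕ) = k * n) :
    ∃ u : Tens d (k * n),
      u ≠ 0 ∧
      u ∈ Submodule.span ℂ
        {w : Tens d (k * n) | ∃ g : Matrix (Fin d) (Fin d) ℂ,
          IsUnit g.det ∧ w = glAct g (castTens hq (vlam d (padWeight hkd lam)))} ∧
      ∃ α : Equiv.Perm (Fin (k * n)) → ℂ,
        u = ∑ π : Equiv.Perm (Fin (k * n)), α π • permAct π (ket (baseWord d k n hkd)) := by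
  set v := castTens hq (vlam d (padWeight hkd lam)) with hv
  set g : Matrix (Fin d) (Fin d) ℂ := Matrix.vandermonde fun a : Fin d => ((a : ℕ) : ℂ) with hg
  set b := baseWord d k n hkd
  have hgdet : g.det ≠ 0 := Matrix.det_vandermonde_ne_zero_iff.mpr
    fun x y h => Fin.ext (Nat.cast_injective h)
  obtain ⟨σ, hσ⟩ := exists_perm_baseWord_comp_eq_mod d k n hkd
  have hcoeff : glAct g v (b ∘ σ) ≠ 0 := by
    rw [hv, glAct_castTens]
    refine glAct_vandermonde_tprodFam_ne_zero (k := k) _ _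
      (fun j => colLen_padWeight_le hkd lam j) (fun j => colLen_le _ _ _) 0 _ fun x => ?_
    simpa using hσ (Fin.cast hq x)
  refine ⟨fun i => if ∀ a, letterCount i a = letterCount b a then glAct g v i else 0,
    fun h => hcoeff ?_, ?_, ?_⟩
  · simpa [letterCount_comp_perm] using congrFun h (b ∘ σ)
  · refine weight_component_mem _ (glAct g v) (fun z hz => ?_) _ (letterCount_le b)
    refine Submodule.subset_span ⟨Matrix.diagonal z * g, ?_, (glAct_diagonal_mul z g v).symm⟩
    rw [Matrix.det_mul, Matrix.det_diagonal, isUnit_iff_ne_zero]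
    exact mul_ne_zero (Finset.prod_ne_zero_iff.mpr fun a _ => hz a) hgdet
  · obtain ⟨α, hα⟩ := (Submodule.mem_span_range_iff_exists_fun ℂ).mp
      (mem_span_permAct_ket b
        (fun i => if ∀ a, letterCount i a = letterCount b a then glAct g v i else 0)
        fun i hi => exists_perm_of_letterCount_eq (ite_ne_right_iff.mp hi).1)
    exact ⟨α, hα.symm⟩
end

section
/- Let $k \le d$, $n \ge 1$, and let $\lambda$ be a partition of $kn$ into at most $k$ parts. Let $v_\lambda \in (\mathbb{C}^d)^{\otimes nk}$ be the highest weight vector of weight $\lambda$ given by the tensor product of Slater determinants along the columns of $\lambda$. Then there exist a real invertible matrix $g \in \mathsf{GL}_d(\mathbb{R})$ and a permutation $\pi \in \mathsf{S}_{nk}$ such that $\langle v_\lambda,\ g\,\pi\,|1^{\otimes n} 2^{\otimes n} \cdots k^{\otimes n}\rangle \rangle \neq 0$, where the pairing is the standard Hermitian inner product on $(\mathbb{C}^d)^{\otimes nk}$ and $|1^{\otimes n} \cdots k^{\otimes n}\rangle = |1\rangle^{\otimes n} \otimes \cdots \otimes |k\rangle^{\otimes n}$. -/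
open scoped BigOperators

lemma permAct_ket {d q : ℕ} (π : Equiv.Perm (Fin q)) (j : Fin q → Fin d) :
    permAct π (ket j) = ket (j ∘ π.symm) := by
  funext i
  have h : i ∘ π = j ↔ i = j ∘ π.symm := (Equiv.eq_comp_symm π i j).symm
  simp only [permAct, ket, h]

lemma glAct_ket {d q : ℕ} (g : Matrix (Fin d) (Fin d) ℂ) (w : Fin q → Fin d) :
    glAct g (ket w) = fun i => ∏ t, g (i t) (w t) := by
  funext i
  simp [glAct, ket]

lemma tinner_castTens_glAct_ket {d p q : ℕ} (h : p = q) (g : Matrix (Fin d) (Fin d) ℂ)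
    (v : Tens d p) (w : Fin q → Fin d) :
    tinner (castTens h v) (glAct g (ket w)) =
      tinner v (glAct g (ket fun a => w (Fin.cast h a))) := by
  subst h
  rfl

lemma tinner_tmul_glAct_ket {d p q : ℕ} (g : Matrix (Fin d) (Fin d) ℂ)
    (v : Tens d p) (v' : Tens d q) (w : Fin (p + q) → Fin d) :
    tinner (tmul v v') (glAct g (ket w)) =
      tinner v (glAct g (ket fun a => w (Fin.castAdd q a))) *
        tinner v' (glAct g (ket fun b => w (Fin.natAdd p b))) := by
  simp only [glAct_ket, tinner]
  rw [← (Fin.appendEquiv p q).sum_comp, Fintype.sum_prod_type, Finset.sum_mul_sum]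
  refine Finset.sum_congr rfl fun i _ => Finset.sum_congr rfl fun j _ => ?_
  simp only [tmul, Fin.appendEquiv, Equiv.coe_fn_mk, Fin.append_left, Fin.append_right,
    Fin.prod_univ_add, map_mul]
  ring

/-- If every factor of a tensor product pairs nontrivially with every window of the letter
sequence `w`, then so does the whole product. -/
lemma tinner_tprodFam_ne_zero {d : ℕ} (g : Matrix (Fin d) (Fin d) ℂ) (w : ℕ → Fin d) :
    ∀ (m : ℕ) (c : Fin m → ℕ) (v : ∀ j, Tens d (c j)),
      (∀ j s, tinner (v j) (glAct g (ket fun t : Fin (c j) => w (s + t))) ≠ 0) →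
      ∀ s, tinner (tprodFam m c v)
        (glAct g (ket fun t : Fin (∑ j, c j) => w (s + t))) ≠ 0
  | 0, c, v, _, s => by
    rw [glAct_ket, tinner]
    have : IsEmpty (Fin (∑ j, c j)) := by simpa using Fin.isEmpty
    simp [tprodFam]
  | m + 1, c, v, h, s => by
    rw [tprodFam, tinner_castTens_glAct_ket, tinner_tmul_glAct_ket]
    refine mul_ne_zero (h 0 s) ?_
    have := tinner_tprodFam_ne_zero g w m _ _ (fun j => h j.succ) (s + c 0)
    simpa [add_assoc] using this

lemma tinner_slater_glAct_ket {d c : ℕ} (h : c ≤ d) (g : Matrix (Fin d) (Fin d) ℂ)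
    (w : Fin c → Fin d) :
    tinner (slater d c h) (glAct g (ket w)) = (g.submatrix (Fin.castLE h) w).det := by
  rw [glAct_ket, Matrix.det_apply', ← Equiv.sum_comp (Equiv.inv (Equiv.Perm (Fin c)))]
  simp only [tinner, slater, permAct_ket, Finset.sum_apply, Pi.smul_apply, smul_eq_mul, map_sum,
    map_mul, Finset.sum_mul]
  rw [Finset.sum_comm]
  refine Finset.sum_congr rfl fun π _ => ?_
  rw [Finset.sum_eq_single ((fun t => Fin.castLE h t) ∘ π.symm)]
  · simp [ket]
  · intro i _ hi
    simp [ket, hi]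
  · simp

lemma det_pow_submatrix_ne_zero {d c : ℕ} (h : c ≤ d) (w : Fin c → Fin d)
    (hw : Function.Injective w) :
    ((Matrix.of fun a b : Fin d => ((b : ℕ) : ℂ) ^ (a : ℕ)).submatrix
      (Fin.castLE h) w).det ≠ 0 := by
  have : (Matrix.of fun a b : Fin d => ((b : ℕ) : ℂ) ^ (a : ℕ)).submatrix (Fin.castLE h) w =
      (Matrix.vandermonde fun t => ((w t : ℕ) : ℂ)).transpose := by
    ext a t
    simp [Matrix.vandermonde]
  rw [this, Matrix.det_transpose, Matrix.det_vandermonde_ne_zero_iff]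
  exact Nat.cast_injective.comp (Fin.val_injective.comp hw)

/-- The letter sequence `1, 2, …, k, 1, 2, …, k, …` of length `kn` is a rearrangement of
`1^n 2^n ⋯ k^n`. -/
lemma exists_perm_baseWord_comp_symm {d k n : ℕ} (hk : 0 < k) (hkd : k ≤ d) :
    ∃ π : Equiv.Perm (Fin (k * n)), baseWord d k n hkd ∘ π.symm =
      fun x : Fin (k * n) => Fin.castLE hkd ⟨(x : ℕ) % k, Nat.mod_lt _ hk⟩ := by
  let σ : Equiv.Perm (Fin (k * n)) :=
    (finCongr (Nat.mul_comm k n)).trans (finProdFinEquiv.symm.trans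
      ((Equiv.prodComm (Fin n) (Fin k)).trans finProdFinEquiv))
  refine ⟨σ.symm, funext fun x => Fin.ext ?_⟩
  have hn : 0 < n := Nat.pos_of_ne_zero (by rintro rfl; exact absurd x.isLt (by simp))
  have hx : (x : ℕ) / k < n := Nat.div_lt_of_lt_mul x.isLt
  simp [σ, baseWord, blockWord, finProdFinEquiv, Fin.divNat, Fin.modNat,
    Nat.add_mul_div_left _ _ hn, Nat.div_eq_of_lt hx]

/-- For `k ≤ d`, `n ≥ 1` and a partition `λ` of `kn` into at most `k` parts, there are a
real invertible matrix `g ∈ GL_d(ℝ)` and a permutation `π ∈ S_{nk}` with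
`⟨v_λ, g π |1^{⊗n} 2^{⊗n} ⋯ k^{⊗n}⟩⟩ ≠ 0`, where `v_λ ∈ (ℂ^d)^{⊗ nk}` is the highest
weight vector of weight `λ` given by the tensor product of Slater determinants along the
columns of `λ`. -/
theorem exists_real_matrix_inner_ne_zero (d k n : ℕ) (hk : 1 ≤ k) (hkd : k ≤ d)
    (hn : 1 ≤ n) (lam : Fin k → ℕ) (hlam : Antitone lam) (hsum : ∑ i, lam i = k * n)
    (hq : ∑ j : Fin (Finset.univ.sup (padWeight hkd lam)),
        colLen d (padWeight hkd lam) (j : ℕ) = k * n) :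
    ∃ (g : Matrix (Fin d) (Fin d) ℝ) (π : Equiv.Perm (Fin (k * n))),
      IsUnit g.det ∧
      tinner (castTens hq (vlam d (padWeight hkd lam)))
        (glAct (g.map fun r => (r : ℂ)) (permAct π (ket (baseWord d k n hkd)))) ≠ 0 := by
  obtain ⟨π, hπ⟩ := exists_perm_baseWord_comp_symm (n := n) hk hkd
  have hg : (Matrix.of fun a b : Fin d => ((b : ℕ) : ℝ) ^ (a : ℕ)).map (fun r => (r : ℂ)) =
      Matrix.of fun a b : Fin d => ((b : ℕ) : ℂ) ^ (a : ℕ) := by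
    ext a b
    simp
  refine ⟨Matrix.of fun a b : Fin d => ((b : ℕ) : ℝ) ^ (a : ℕ), π, ?_, ?_⟩
  · rw [isUnit_iff_ne_zero]
    have : (Matrix.of fun a b : Fin d => ((b : ℕ) : ℝ) ^ (a : ℕ)) =
        (Matrix.vandermonde fun b : Fin d => ((b : ℕ) : ℝ)).transpose := by
      ext a b
      simp [Matrix.vandermonde]
    rw [this, Matrix.det_transpose, Matrix.det_vandermonde_ne_zero_iff]
    exact Nat.cast_injective.comp Fin.val_injective
  · rw [hg, permAct_ket, hπ, tinner_castTens_glAct_ket]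
    have key := tinner_tprodFam_ne_zero
      (Matrix.of fun a b : Fin d => ((b : ℕ) : ℂ) ^ (a : ℕ))
      (fun x => Fin.castLE hkd ⟨x % k, Nat.mod_lt _ hk⟩) _ _
      (fun j : Fin (Finset.univ.sup (padWeight hkd lam)) =>
        slater d (colLen d (padWeight hkd lam) (j : ℕ)) (colLen_le d _ (j : ℕ))) ?_ 0
    · simpa [vlam] using key
    · intro j s
      rw [tinner_slater_glAct_ket]
      refine det_pow_submatrix_ne_zero _ _ fun a b hab => Fin.ext ?_
      have hmod : (s + a) % k = (s + b) % k := by simpa [Fin.ext_iff] using hab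
      have hle := colLen_padWeight_le hkd lam j
      exact (Nat.ModEq.add_left_cancel' s hmod).eq_of_lt_of_lt
        (a.isLt.trans_le hle) (b.isLt.trans_le hle)
end

section
/- Let $n, k, d$ be natural numbers with $n, k \ge 1$, and let $w \in (\mathbb{C}^d)^{\otimes nk}$ be a vector all of whose coordinates in the computational basis are real. Let $\phi = \sum_{i=1}^d |i\rangle^{\otimes 2n} \in (\mathbb{C}^d)^{\otimes 2n}$ and $\psi = \phi^{\otimes k} \in (\mathbb{C}^d)^{\otimes 2nk}$, and let $\sigma \in \mathsf{S}_{2nk}$ be the permutation with $(\sigma(1), \ldots, \sigma(2nk)) = (1, 3, 5, \ldots, 2nk-1, 2, 4, 6, \ldots, 2nk)$. Then $\langle \sigma(w \otimes w),\ \psi \rangle = \sum_{i_1=1}^d \cdots \sum_{i_k=1}^d \big( \langle w,\ |i_1\rangle^{\otimes n} \otimes \cdots \otimes |i_k\rangle^{\otimes n} \rangle \big)^2$; in particular this inner product is a nonnegative real number, and it is strictly positive if $\langle w,\ |1\rangle^{\otimes n} \otimes |2\rangle^{\otimes n} \otimes \cdots \otimes |k\rangle^{\otimes n}\rangle \neq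 0$ (assuming $k \le d$ for this last clause). -/
open scoped BigOperators

/-- Pairing with a computational basis vector reads off a conjugated coordinate. -/
lemma tinner_ket {d q : ℕ} (v : Tens d q) (j : Fin q → Fin d) :
    tinner v (ket j) = (starRingEnd ℂ) (v j) := by
  simp [tinner, ket]

/-- The inner product is additive in its second argument. -/
lemma tinner_sum {d q : ℕ} {ι : Type*} (s : Finset ι) (v : Tens d q) (f : ι → Tens d q) :
    tinner v (∑ i ∈ s, f i) = ∑ i ∈ s, tinner v (f i) := by
  simp only [tinner, Finset.sum_apply, Finset.mul_sum]
  exact Finset.sum_comm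

lemma castTens_sum {d p q : ℕ} {ι : Type*} (h : p = q) (s : Finset ι) (f : ι → Tens d p) :
    castTens h (∑ i ∈ s, f i) = ∑ i ∈ s, castTens h (f i) := by
  subst h
  rfl

lemma castTens_ket {d p q : ℕ} (h : p = q) (j : Fin p → Fin d) :
    castTens h (ket j) = ket fun a => j (Fin.cast h.symm a) := by
  subst h
  rfl

/-- Sorting a word with blocks of length `2n` into its entries at even and at odd positions
(counted from `0`) gives two copies of the word with blocks of length `n`. -/
lemma permAct_tmul_blockWord {d k n : ℕ} (w : Tens d (k * n))
    (σ : Equiv.Perm (Fin (k * n + k * n)))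
    (hσ : ∀ t : Fin (k * n + k * n),
      ((σ t : ℕ) = if (t : ℕ) < k * n then 2 * (t : ℕ) else 2 * ((t : ℕ) - k * n) + 1))
    (h : k * n + k * n = k * (2 * n)) (i : Fin k → Fin d) :
    permAct σ (tmul w w) (fun a => blockWord d k (2 * n) i (Fin.cast h a))
      = w (blockWord d k n i) ^ 2 := by
  have h_even : (fun a : Fin (k * n) =>
      blockWord d k (2 * n) i (Fin.cast h (σ (Fin.castAdd (k * n) a)))) = blockWord d k n i := by
    funext a
    simp only [blockWord]
    congr 2
    simp [hσ, Nat.mul_div_mul_left]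
  have h_odd : (fun a : Fin (k * n) =>
      blockWord d k (2 * n) i (Fin.cast h (σ (Fin.natAdd (k * n) a)))) = blockWord d k n i := by
    funext a
    simp only [blockWord]
    congr 2
    simp only [Fin.val_cast, hσ, Fin.val_natAdd]
    rw [if_neg (by omega), ← Nat.div_div_eq_div_mul]
    congr 1
    omega
  simp only [permAct, tmul, Function.comp_def, h_even, h_odd, sq]


/-- The sum-of-squares computation.  Let `w ∈ (ℂ^d)^{⊗ nk}` have real coordinates in the
computational basis, let `φ = ∑_{i=1}^d |i⟩^{⊗2n}`, `ψ = φ^{⊗k} ∈ (ℂ^d)^{⊗2nk}`, and let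
`σ ∈ S_{2nk}` be the sorting permutation `(σ(1), …, σ(2nk)) = (1, 3, …, 2nk-1, 2, 4, …, 2nk)`
(written `0`-indexed below).  Then
`⟨σ(w ⊗ w), ψ⟩ = ∑_{i₁,…,i_k} (⟨w, |i₁⟩^{⊗n} ⊗ ⋯ ⊗ |i_k⟩^{⊗n}⟩)²`; in particular this
inner product is a nonnegative real, strictly positive if `k ≤ d` and
`⟨w, |1⟩^{⊗n} ⊗ ⋯ ⊗ |k⟩^{⊗n}⟩ ≠ 0`. -/
theorem inner_sorted_square_psi (d k n : ℕ) (hk : 1 ≤ k) (hn : 1 ≤ n)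
    (w : Tens d (k * n)) (hw : ∀ j : Fin (k * n) → Fin d, (w j).im = 0)
    (σ : Equiv.Perm (Fin (k * n + k * n)))
    (hσ : ∀ t : Fin (k * n + k * n),
      ((σ t : ℕ) = if (t : ℕ) < k * n then 2 * (t : ℕ) else 2 * ((t : ℕ) - k * n) + 1)) :
    tinner (permAct σ (tmul w w)) (psiVec d k n)
        = ∑ i : Fin k → Fin d, (tinner w (ket (blockWord d k n i))) ^ 2
      ∧ (tinner (permAct σ (tmul w w)) (psiVec d k n)).im = 0
      ∧ 0 ≤ (tinner (permAct σ (tmul w w)) (psiVec d k n)).re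
      ∧ ∀ hkd : k ≤ d, tinner w (ket (baseWord d k n hkd)) ≠ 0 →
          0 < (tinner (permAct σ (tmul w w)) (psiVec d k n)).re := by
  have h_eq : tinner (permAct σ (tmul w w)) (psiVec d k n)
      = ∑ i : Fin k → Fin d, (tinner w (ket (blockWord d k n i))) ^ 2 := by
    simp only [psiVec, castTens_sum, castTens_ket, tinner_sum, tinner_ket,
      permAct_tmul_blockWord w σ hσ, map_pow]
  have h_real : ∀ j, tinner w (ket j) = ((w j).re : ℂ) := fun j => by
    rw [tinner_ket]
    apply Complex.ext <;> simp [hw j]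
  have h_ofReal : tinner (permAct σ (tmul w w)) (psiVec d k n)
      = ((∑ i : Fin k → Fin d, (w (blockWord d k n i)).re ^ 2 : ℝ) : ℂ) := by
    simp only [h_eq, h_real]
    push_cast
    rfl
  refine ⟨h_eq, ?_, ?_, fun hkd hne => ?_⟩
  · rw [h_ofReal, Complex.ofReal_im]
  · rw [h_ofReal, Complex.ofReal_re]
    positivity
  · rw [h_ofReal, Complex.ofReal_re]
    refine Finset.sum_pos' (fun _ _ => sq_nonneg _)
      ⟨fun b => Fin.castLE hkd b, Finset.mem_univ _, ?_⟩
    rw [h_real, Complex.ofReal_ne_zero] at hne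
    exact sq_pos_of_ne_zero hne
end
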